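/- arXiv:1805.07716 — 14 statements merged into one kernel-verified Lean document; each statement's English description precedes it below -/
import Mathlib

section
/- Let n ≥ 1 and let λ₁, λ₂, …, λₙ be real numbers with λ₁ > 0 ≥ λ₂ ≥ ⋯ ≥ λₙ and λ₁ + λ₂ + ⋯ + λₙ ≥ 0. Then there exists an n×n real matrix M with all entries nonnegative whose characteristic polynomial equals ∏_{i=1}^{n} (X − λᵢ) (equivalently, whose spectrum counted with multiplicity is {λ₁, …, λₙ}). -/
open Polynomial Matrix

/-- If `M * S = S * T` with `S` invertible, then `M` and `T` have the same characteristic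
polynomial. -/
lemma Matrix.charpoly_eq_of_mul_eq_mul {ι R : Type*} [Fintype ι] [DecidableEq ι] [CommRing R]
    {M S T : Matrix ι ι R} (hS : IsUnit S) (h : M * S = S * T) : M.charpoly = T.charpoly := by
  obtain ⟨u, rfl⟩ := hS
  rw [← Matrix.charpoly_units_conj u T, ← h, mul_assoc, ← Matrix.coe_units_inv, Units.mul_inv, mul_one]

/-- Suleimanova's theorem: if `λ₁ > 0 ≥ λ₂ ≥ ⋯ ≥ λₙ` and the sum of the `λᵢ` is
nonnegative, then there is a nonnegative `n × n` real matrix whose characteristic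
polynomial is `∏ (X - λᵢ)`. (Here the list has length `n + 1 ≥ 1`.) -/
theorem stmt_0 (n : ℕ) (l : Fin (n + 1) → ℝ)
    (hpos : 0 < l 0)
    (hneg : ∀ i : Fin (n + 1), i ≠ 0 → l i ≤ 0)
    (hmono : ∀ i j : Fin (n + 1), i ≤ j → l j ≤ l i)
    (hsum : 0 ≤ ∑ i, l i) :
    ∃ M : Matrix (Fin (n + 1)) (Fin (n + 1)) ℝ,
      (∀ i j, 0 ≤ M i j) ∧ M.charpoly = ∏ i, (X - C (l i)) := by
  let M : Matrix (Fin (n + 1)) (Fin (n + 1)) ℝ := of fun i j =>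
    if j = 0 then (∑ k, l k) - (if i = 0 then 0 else l i) else if i = j then 0 else -l j
  let S : Matrix (Fin (n + 1)) (Fin (n + 1)) ℝ := of fun i j =>
    if j = 0 then 1 else if i = j then 1 else 0
  let T : Matrix (Fin (n + 1)) (Fin (n + 1)) ℝ := of fun i j =>
    if i = j then l i else if i = 0 then -l j else 0
  have hS : IsUnit S := by
    have hlow : S.IsLowerTriangular := by
      intro i j hij
      have hij' : i < j := hij
      simp [S, hij'.ne, (Fin.zero_le i |>.trans_lt hij').ne']
    rw [Matrix.isUnit_iff_isUnit_det, Matrix.det_of_isLowerTriangular S hlow]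
    simp [S]
  have hT : T.IsUpperTriangular := by
    intro i j hij
    have hij' : j < i := hij
    simp [T, hij'.ne', (Fin.zero_le j |>.trans_lt hij').ne']
  have hMST : M * S = S * T := by
    ext i j
    simp only [Matrix.mul_apply, Fin.sum_univ_succ, M, S, T, of_apply]
    refine Fin.cases ?_ (fun i => ?_) i <;> refine Fin.cases ?_ (fun j => ?_) j
    · simp [(Fin.succ_ne_zero _).symm]
    · simp [Fin.succ_ne_zero, (Fin.succ_ne_zero _).symm]
    · have h : ∑ k : Fin n, (if i = k then 0 else -l k.succ) =
          l i.succ - ∑ k : Fin n, l k.succ := by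
        rw [eq_sub_iff_add_eq, ← Finset.sum_add_distrib,
          Finset.sum_congr rfl (g := fun k => if i = k then l k.succ else 0)
            (fun k _ => by split_ifs <;> simp)]
        simp
      simp [Fin.succ_ne_zero, h]
    · simp [Fin.succ_ne_zero, (Fin.succ_ne_zero _).symm]
      split_ifs <;> simp_all
  refine ⟨M, fun i j => ?_, ?_⟩
  · simp only [M, of_apply]
    split_ifs with hj hi hij
    · simpa using hsum
    · linarith [hneg i hi]
    · exact le_rfl
    · linarith [hneg j hj]
  · rw [Matrix.charpoly_eq_of_mul_eq_mul hS hMST, Matrix.charpoly_of_isUpperTriangular T hT]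
    simp [T]
end

section
/- Let n ≥ 1 and let λ₁, λ₂, …, λₙ be real numbers with λ₁ > 0 ≥ λ₂ ≥ ⋯ ≥ λₙ and λ₁ + λ₂ + ⋯ + λₙ = 0. Then there exists an n×n real matrix M with all entries nonnegative, with every diagonal entry of M equal to 0, whose characteristic polynomial equals ∏_{i=1}^{n} (X − λᵢ). -/
open Polynomial Matrix

/-- The companion matrix of a monic polynomial, with the coefficients in the last column,
has that polynomial as characteristic polynomial. -/
theorem charpoly_companion {K : Type*} [Field K] {n : ℕ} {p : K[X]} (hp : p.Monic) (hn : p.natDegree = n) :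
    (Matrix.of fun i j : Fin n ↦
      if (j : ℕ) + 1 = n then -p.coeff i else if (i : ℕ) = j + 1 then 1 else 0).charpoly = p := by
  subst hn
  have h := charpoly_leftMulMatrix (AdjoinRoot.powerBasis hp.ne_zero)
  rw [PowerBasis.leftMulMatrix, PowerBasis.minpolyGen_eq,
    AdjoinRoot.minpoly_powerBasis_gen_of_monic hp] at h
  exact h

/-- Consecutive coefficients of `∏ (X + μᵢ)` with `μᵢ ≥ 0`: each is nonnegative, and is at most
`∑ μᵢ` times the next one. -/
theorem coeff_prod_X_add_C_bounds {ι : Type*} (s : Finset ι) (m : ι → ℝ)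
    (hm : ∀ i ∈ s, 0 ≤ m i) :
    (∀ k, 0 ≤ (∏ i ∈ s, (X + C (m i))).coeff k) ∧
      ∀ k < s.card, (∏ i ∈ s, (X + C (m i))).coeff k ≤
        (∑ i ∈ s, m i) * (∏ i ∈ s, (X + C (m i))).coeff (k + 1) := by
  classical
  induction s using Finset.induction_on with
  | empty =>
    refine ⟨fun k ↦ ?_, by simp⟩
    rw [Finset.prod_empty, coeff_one]
    split_ifs <;> norm_num
  | insert a s ha ih =>
    obtain ⟨hnn, hle⟩ := ih fun i hi ↦ hm i (Finset.mem_insert_of_mem hi)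
    have hma : 0 ≤ m a := hm a (Finset.mem_insert_self a s)
    have hs : 0 ≤ ∑ i ∈ s, m i :=
      Finset.sum_nonneg fun i hi ↦ hm i (Finset.mem_insert_of_mem hi)
    rw [Finset.prod_insert ha, Finset.sum_insert ha, Finset.card_insert_of_notMem ha]
    generalize (∏ i ∈ s, (X + C (m i))) = q at *
    generalize (∑ i ∈ s, m i) = t at *
    have hsucc (k : ℕ) : ((X + C (m a)) * q).coeff (k + 1) = q.coeff k + m a * q.coeff (k + 1) := by
      rw [add_mul, coeff_add, coeff_X_mul, coeff_C_mul]
    have hzero : ((X + C (m a)) * q).coeff 0 = m a * q.coeff 0 := by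
      simp [add_mul]
    constructor
    · rintro (_ | k)
      · rw [hzero]
        exact mul_nonneg hma (hnn 0)
      · rw [hsucc]
        exact add_nonneg (hnn k) (mul_nonneg hma (hnn _))
    · rintro (_ | k) hk
      · rw [hzero, hsucc]
        nlinarith [mul_nonneg hs (hnn 0), mul_nonneg (add_nonneg hma hs) (mul_nonneg hma (hnn 1))]
      · rw [hsucc, hsucc]
        nlinarith [hle k (by omega),
          mul_nonneg (add_nonneg hma hs) (mul_nonneg hma (hnn (k + 1 + 1)))]

/-- If `λ₁ > 0 ≥ λ₂ ≥ ⋯ ≥ λₙ` and the sum of the `λᵢ` is zero, then there is a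
nonnegative `n × n` real matrix with zero diagonal whose characteristic polynomial
is `∏ (X - λᵢ)`. -/
theorem stmt_1 (n : ℕ) (l : Fin (n + 1) → ℝ)
    (hpos : 0 < l 0)
    (hneg : ∀ i : Fin (n + 1), i ≠ 0 → l i ≤ 0)
    (hmono : ∀ i j : Fin (n + 1), i ≤ j → l j ≤ l i)
    (hsum : ∑ i, l i = 0) :
    ∃ M : Matrix (Fin (n + 1)) (Fin (n + 1)) ℝ,
      (∀ i j, 0 ≤ M i j) ∧ (∀ i, M i i = 0) ∧ M.charpoly = ∏ i, (X - C (l i)) := by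
  have hfactor : ∏ i, (X - C (l i)) =
      (X - C (l 0)) * ∏ i : Fin n, (X + C (-l i.succ)) := by
    rw [Fin.prod_univ_succ]
    simp [sub_eq_add_neg]
  have hl0 : l 0 = ∑ i : Fin n, -l i.succ := by
    rw [Fin.sum_univ_succ] at hsum
    rw [Finset.sum_neg_distrib]
    linarith
  obtain ⟨hnn, hle⟩ := coeff_prod_X_add_C_bounds Finset.univ (fun i : Fin n ↦ -l i.succ)
    fun i _ ↦ neg_nonneg.2 (hneg _ i.succ_ne_zero)
  rw [← hl0] at hle
  have hmonic : (∏ i, (X - C (l i))).Monic := monic_prod_X_sub_C _ _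
  have hdeg : (∏ i, (X - C (l i))).natDegree = n + 1 := by
    simp [natDegree_finsetProd_X_sub_C_eq_card]
  have hcoeff (k : ℕ) (hk : k < n + 1) : (∏ i, (X - C (l i))).coeff k ≤ 0 := by
    rw [hfactor, sub_mul, coeff_sub, coeff_C_mul]
    cases k with
    | zero => simpa using mul_nonneg hpos.le (hnn 0)
    | succ k =>
      rw [coeff_X_mul, sub_nonpos]
      exact hle k (by simpa using hk)
  have htrace : (∏ i, (X - C (l i))).coeff n = 0 := by
    have h := prod_X_sub_C_coeff_card_pred Finset.univ l (by simp)
    simpa [hsum] using h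
  refine ⟨_, fun i j ↦ ?_, fun i ↦ ?_, charpoly_companion hmonic hdeg⟩
  · rw [Matrix.of_apply]
    split_ifs
    · exact neg_nonneg.2 (hcoeff i i.isLt)
    · exact zero_le_one
    · exact le_rfl
  · rw [Matrix.of_apply]
    split_ifs with h
    · rw [Nat.succ_injective h, htrace, neg_zero]
    · omega
    · rfl
end

section
/- Let λ₁, λ₂, λ₃, α₂, α₃ be real numbers with λ₂ ≤ 0, λ₃ ≤ 0, α₂ ≥ −λ₂, α₃ ≥ −λ₃ and α₂ + α₃ ≤ λ₁. Then the 3×3 matrix C = [[λ₁ − α₂ − α₃, α₂, α₃], [λ₁ − α₂ − λ₂ − α₃, α₂ + λ₂, α₃], [λ₁ − α₂ − α₃ − λ₃, α₂, α₃ + λ₃]] has all entries nonnegative and its characteristic polynomial equals (X − λ₁)(X − λ₂)(X − λ₃). -/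
open Polynomial Matrix

/-- For `λ₂ ≤ 0`, `λ₃ ≤ 0`, `α₂ ≥ -λ₂`, `α₃ ≥ -λ₃` and `α₂ + α₃ ≤ λ₁`, the matrix
`[[λ₁-α₂-α₃, α₂, α₃], [λ₁-α₂-λ₂-α₃, α₂+λ₂, α₃], [λ₁-α₂-α₃-λ₃, α₂, α₃+λ₃]]`
is nonnegative with characteristic polynomial `(X-λ₁)(X-λ₂)(X-λ₃)`. -/
theorem stmt_3 (l₁ l₂ l₃ α₂ α₃ : ℝ) (h₂ : l₂ ≤ 0) (h₃ : l₃ ≤ 0)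
    (hα₂ : -l₂ ≤ α₂) (hα₃ : -l₃ ≤ α₃) (hsum : α₂ + α₃ ≤ l₁) :
    (∀ i j, 0 ≤ (!![l₁ - α₂ - α₃, α₂, α₃;
                    l₁ - α₂ - l₂ - α₃, α₂ + l₂, α₃;
                    l₁ - α₂ - α₃ - l₃, α₂, α₃ + l₃] : Matrix (Fin 3) (Fin 3) ℝ) i j) ∧
      (!![l₁ - α₂ - α₃, α₂, α₃;
          l₁ - α₂ - l₂ - α₃, α₂ + l₂, α₃;
          l₁ - α₂ - α₃ - l₃, α₂, α₃ + l₃] : Matrix (Fin 3) (Fin 3) ℝ).charpoly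
        = (X - C l₁) * (X - C l₂) * (X - C l₃) := by
  constructor
  · intro i j
    fin_cases i <;> fin_cases j <;> simp <;> linarith
  · rw [Matrix.charpoly, Matrix.det_fin_three]
    simp
    ring
end

section
/- Let n ≥ 2, let λ₁, …, λₙ be real numbers with λᵢ ≤ 0 for all i ≥ 2, let α₂, …, αₙ be real numbers with αᵢ ≥ −λᵢ for all i ≥ 2, and set t = α₂ + ⋯ + αₙ; assume t ≤ λ₁. Define the n×n matrix C by: C₁₁ = λ₁ − t; Cᵢ₁ = λ₁ − λᵢ − t for 2 ≤ i ≤ n; Cⱼⱼ = αⱼ + λⱼ for 2 ≤ j ≤ n; and Cᵢⱼ = αⱼ for 2 ≤ j ≤ n with i ≠ j. Then C has all entries nonnegative and its characteristic polynomial equals ∏_{i=1}^{n} (X − λᵢ). -/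
open Polynomial Matrix

/-- A matrix that intertwines with an upper triangular matrix through an invertible matrix has
the characteristic polynomial given by the diagonal of the triangular one. -/
lemma charpoly_eq_prod_of_mul_eq_mul_upperTriangular {R m : Type*} [CommRing R] [Fintype m]
    [DecidableEq m] [LinearOrder m] {M P B : Matrix m m R} (hP : IsUnit P.det)
    (hB : B.IsUpperTriangular) (h : M * P = P * B) :
    M.charpoly = ∏ i, (X - C (B i i)) := by
  have hM : M = P * (B * P⁻¹) := by
    rw [← Matrix.mul_assoc, ← h, Matrix.mul_nonsing_inv_cancel_right _ _ hP]
  rw [hM, Matrix.charpoly_mul_comm, Matrix.nonsing_inv_mul_cancel_right _ _ hP,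
    Matrix.charpoly_of_isUpperTriangular _ hB]

/-- General form of the Suleimanova realization: with `λᵢ ≤ 0` and `αᵢ ≥ -λᵢ` for
`i ≥ 2` and `t = α₂ + ⋯ + αₙ ≤ λ₁`, the matrix `C` with `C₁₁ = λ₁ - t`,
`Cᵢ₁ = λ₁ - λᵢ - t` for `i ≥ 2`, `Cⱼⱼ = αⱼ + λⱼ` for `j ≥ 2` and `Cᵢⱼ = αⱼ`
otherwise, is nonnegative with characteristic polynomial `∏ (X - λᵢ)`.
(Here the size is `n + 2 ≥ 2`.) -/
theorem stmt_4 (n : ℕ) (l α : Fin (n + 2) → ℝ)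
    (hneg : ∀ i : Fin (n + 2), i ≠ 0 → l i ≤ 0)
    (hα : ∀ i : Fin (n + 2), i ≠ 0 → -l i ≤ α i)
    (t : ℝ) (ht : t = ∑ i ∈ Finset.univ.erase 0, α i)
    (htl : t ≤ l 0)
    (M : Matrix (Fin (n + 2)) (Fin (n + 2)) ℝ)
    (hM : ∀ i j, M i j =
      if j = 0 then (if i = 0 then l 0 - t else l 0 - l i - t)
      else if i = j then α j + l j else α j) :
    (∀ i j, 0 ≤ M i j) ∧ M.charpoly = ∏ i, (X - C (l i)) := by
  have ht' : t = ∑ k : Fin (n + 1), α k.succ := by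
    have h := Finset.add_sum_erase Finset.univ α (Finset.mem_univ 0)
    rw [Fin.sum_univ_succ] at h
    linarith
  constructor
  · intro i j
    rw [hM]
    split_ifs with hj hi hij
    · linarith
    · linarith [hneg i hi]
    · linarith [hα j hj]
    · linarith [hα j hj, hneg j hj]
  · let P : Matrix (Fin (n + 2)) (Fin (n + 2)) ℝ :=
      Matrix.of fun i j => if i = j then 1 else if j = 0 then 1 else 0
    let B : Matrix (Fin (n + 2)) (Fin (n + 2)) ℝ :=
      Matrix.of fun i j => if i = j then l i else if i = 0 then α j else 0
    have hP : IsUnit P.det := by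
      rw [Matrix.det_of_isLowerTriangular P]
      · simp [P]
      · intro i j hij
        have hij' : i < j := hij
        simp [P, hij'.ne, ((Fin.zero_le i).trans_lt hij').ne']
    have hB : B.IsUpperTriangular := by
      intro i j hij
      have hij' : j < i := hij
      simp [B, hij'.ne', ((Fin.zero_le j).trans_lt hij').ne']
    have h : M * P = P * B := by
      ext i j
      rw [Matrix.mul_apply, Matrix.mul_apply, Fin.sum_univ_succ fun k => M i k * P k j,
        Fin.sum_univ_succ fun k => P i k * B k j]
      refine Fin.cases ?_ (fun i => ?_) i <;> refine Fin.cases ?_ (fun j => ?_) j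
      · simp [P, B, hM, Fin.succ_ne_zero, (Fin.succ_ne_zero _).symm, ht']
      · simp [P, B, hM, Fin.succ_ne_zero, (Fin.succ_ne_zero _).symm]
      · have hsum : ∑ k : Fin (n + 1), (if i = k then α k.succ + l k.succ else α k.succ)
            = t + l i.succ := by
          rw [ht']
          have hk (k : Fin (n + 1)) : (if i = k then α k.succ + l k.succ else α k.succ)
              = α k.succ + if i = k then l k.succ else 0 := by
            split_ifs <;> simp
          simp [hk, Finset.sum_add_distrib]
        simp [P, B, hM, Fin.succ_ne_zero, hsum]
        ring
      · simp [P, B, hM, Fin.succ_ne_zero, (Fin.succ_ne_zero _).symm]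
        split_ifs <;> simp
    rw [charpoly_eq_prod_of_mul_eq_mul_upperTriangular hP hB h]
    simp [B]
end

section
/- Let λ₁, λ₂, λ₃, λ₄ be real numbers with λ₁ ≥ λ₂ > 0 ≥ λ₃ ≥ λ₄, λ₁ + λ₂ + λ₃ + λ₄ ≥ 0, λ₁ ≥ |λ₃| and λ₁ ≥ |λ₄|. Then there exists a 4×4 real matrix M with all entries nonnegative whose characteristic polynomial equals (X − λ₁)(X − λ₂)(X − λ₃)(X − λ₄). -/
open Polynomial Matrix

/-- The characteristic polynomial of two symmetric `2 × 2` circulant blocks coupled by constant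
off-diagonal blocks. -/
theorem charpoly_coupled_circulants {R : Type*} [CommRing R] (a b c d s : R) :
    (!![a, b, s, s; b, a, s, s; 1, 1, c, d; 1, 1, d, c] : Matrix (Fin 4) (Fin 4) R).charpoly =
      ((X - C (a + b)) * (X - C (c + d)) - C (4 * s)) * (X - C (a - b)) * (X - C (c - d)) := by
  have h4 : (C (4 : R) : R[X]) = 4 := rfl
  rw [Matrix.charpoly, Matrix.det_succ_row_zero]
  simp [Fin.sum_univ_succ, Matrix.det_fin_three, Matrix.charmatrix_apply, Fin.succAbove, h4]
  ring

/-- Two `2 × 2` blocks with Perron roots `α`, `β` and second eigenvalues `l₃`, `l₄` can be coupled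
so that `α`, `β` are replaced by any `l₁`, `l₂` with the same sum and a smaller product. -/
theorem exists_nonneg_charpoly_of_perron_roots {l₁ l₂ l₃ l₄ α β : ℝ} (h3 : l₃ ≤ 0) (h4 : l₄ ≤ 0)
    (hα : -l₄ ≤ α) (hβ : -l₃ ≤ β) (hadd : α + β = l₁ + l₂) (hmul : l₁ * l₂ ≤ α * β) :
    ∃ M : Matrix (Fin 4) (Fin 4) ℝ,
      (∀ i j, 0 ≤ M i j) ∧
        M.charpoly = (X - C l₁) * (X - C l₂) * (X - C l₃) * (X - C l₄) := by
  refine ⟨!![(α + l₄) / 2, (α - l₄) / 2, (α * β - l₁ * l₂) / 4, (α * β - l₁ * l₂) / 4;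
    (α - l₄) / 2, (α + l₄) / 2, (α * β - l₁ * l₂) / 4, (α * β - l₁ * l₂) / 4;
    1, 1, (β + l₃) / 2, (β - l₃) / 2; 1, 1, (β - l₃) / 2, (β + l₃) / 2], ?_, ?_⟩
  · intro i j
    fin_cases i <;> fin_cases j <;> simp <;> linarith
  · have hC : (C α + C β : ℝ[X]) = C l₁ + C l₂ := by rw [← C_add, hadd, C_add]
    rw [charpoly_coupled_circulants, show (α + l₄) / 2 + (α - l₄) / 2 = α by ring,
      show (β + l₃) / 2 + (β - l₃) / 2 = β by ring,
      show (α + l₄) / 2 - (α - l₄) / 2 = l₄ by ring,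
      show (β + l₃) / 2 - (β - l₃) / 2 = l₃ by ring,
      show 4 * ((α * β - l₁ * l₂) / 4) = α * β - l₁ * l₂ by ring]
    simp only [C_sub, C_mul]
    linear_combination (-X * (X - C l₃) * (X - C l₄)) * hC

/-- If `λ₁ ≥ λ₂ > 0 ≥ λ₃ ≥ λ₄`, the sum is nonnegative, and `λ₁ ≥ |λ₃|, |λ₄|`,
then `{λ₁, λ₂, λ₃, λ₄}` is realizable by a nonnegative `4 × 4` matrix. -/
theorem stmt_5 (l₁ l₂ l₃ l₄ : ℝ)
    (h12 : l₁ ≥ l₂) (h2 : l₂ > 0) (h3 : 0 ≥ l₃) (h34 : l₃ ≥ l₄)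
    (hsum : 0 ≤ l₁ + l₂ + l₃ + l₄)
    (habs3 : |l₃| ≤ l₁) (habs4 : |l₄| ≤ l₁) :
    ∃ M : Matrix (Fin 4) (Fin 4) ℝ,
      (∀ i j, 0 ≤ M i j) ∧
        M.charpoly = (X - C l₁) * (X - C l₂) * (X - C l₃) * (X - C l₄) := by
  have h4 : -l₄ ≤ l₁ := (neg_le_abs l₄).trans habs4
  by_cases h23 : 0 ≤ l₂ + l₃
  · exact exists_nonneg_charpoly_of_perron_roots h3 (h34.le.trans h3) h4 (by linarith) rfl le_rfl
  · refine exists_nonneg_charpoly_of_perron_roots (α := l₁ + l₂ + l₃) (β := -l₃)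
      h3 (h34.le.trans h3) (by linarith) le_rfl (by ring) ?_
    nlinarith [mul_nonneg (neg_le_abs l₃ |>.trans habs3 |> sub_nonneg.mpr)
      (by linarith : 0 ≤ -l₃ - l₂)]
end

section
/- Let λ₁, λ₂, λ₃, λ₄, α₂, α₃, α₄, α be real numbers with λ₁ ≥ λ₂ > 0 ≥ λ₃ ≥ λ₄, αᵢ ≥ −λᵢ for i = 2, 3, 4, α₂ + α₄ ≥ 0, t := α₂ + α₃ + α₄ ≤ λ₁, and −α₃ ≤ α ≤ λ₁ − λ₂ − t. Then the 4×4 matrix C = [[λ₁ − t, α₂ + α₄, α₃, 0], [λ₁ − λ₂ − t − α, α₂ + λ₂, α₃ + α, α₄], [λ₁ − λ₃ − t, α₂ + α₄, α₃ + λ₃, 0], [λ₁ − λ₂ − t − α, α₂ + λ₂ − λ₄, α₃ + α, α₄ + λ₄]] has all entries nonnegative and its characteristic polynomial equals (X − λ₁)(X − λ₂)(X − λ₃)(X − λ₄). -/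
open Polynomial Matrix

/-- The explicit `4 × 4` realization with two positive eigenvalues: under the stated
conditions on `α₂, α₃, α₄, α`, the matrix `C` from equation (2.4) of the paper is
nonnegative with characteristic polynomial `(X-λ₁)(X-λ₂)(X-λ₃)(X-λ₄)`. -/
theorem stmt_6 (l₁ l₂ l₃ l₄ α₂ α₃ α₄ α : ℝ)
    (h12 : l₁ ≥ l₂) (h2 : l₂ > 0) (h3 : 0 ≥ l₃) (h34 : l₃ ≥ l₄)
    (hα₂ : α₂ ≥ -l₂) (hα₃ : α₃ ≥ -l₃) (hα₄ : α₄ ≥ -l₄)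
    (h24 : 0 ≤ α₂ + α₄)
    (ht : α₂ + α₃ + α₄ ≤ l₁)
    (hαlo : -α₃ ≤ α) (hαhi : α ≤ l₁ - l₂ - (α₂ + α₃ + α₄)) :
    (∀ i j, 0 ≤ (!![l₁ - (α₂ + α₃ + α₄), α₂ + α₄, α₃, 0;
                    l₁ - l₂ - (α₂ + α₃ + α₄) - α, α₂ + l₂, α₃ + α, α₄;
                    l₁ - l₃ - (α₂ + α₃ + α₄), α₂ + α₄, α₃ + l₃, 0;
                    l₁ - l₂ - (α₂ + α₃ + α₄) - α, α₂ + l₂ - l₄, α₃ + α, α₄ + l₄]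
                  : Matrix (Fin 4) (Fin 4) ℝ) i j) ∧
      (!![l₁ - (α₂ + α₃ + α₄), α₂ + α₄, α₃, 0;
          l₁ - l₂ - (α₂ + α₃ + α₄) - α, α₂ + l₂, α₃ + α, α₄;
          l₁ - l₃ - (α₂ + α₃ + α₄), α₂ + α₄, α₃ + l₃, 0;
          l₁ - l₂ - (α₂ + α₃ + α₄) - α, α₂ + l₂ - l₄, α₃ + α, α₄ + l₄]
        : Matrix (Fin 4) (Fin 4) ℝ).charpoly
        = (X - C l₁) * (X - C l₂) * (X - C l₃) * (X - C l₄) := by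
  constructor
  · intro i j
    fin_cases i <;> fin_cases j <;> simp <;> linarith
  · simp only [Matrix.charpoly, Matrix.charmatrix, Matrix.det_succ_row_zero, Fin.sum_univ_succ]
    simp [Fin.succAbove, Matrix.diagonal_apply]
    ring
end

section
/- Let λ₁, λ₂, λ₃, λ₄, λ₅, α₂, α₃, α₄, α₅, α be real numbers with λ₁ ≥ λ₂ > 0 > λ₃ ≥ λ₄ ≥ λ₅, αᵢ ≥ −λᵢ for i = 2, 3, 4, 5, α₄ + α₅ ≥ λ₂, t := α₂ + α₃ + α₄ + α₅ ≤ λ₁, and −α₃ ≤ α ≤ λ₁ − λ₂ − t. Then the 5×5 matrix C = [[λ₁ − t, α₂ + α₄ + α₅, α₃, 0, 0], [λ₁ − λ₂ − t − α, α₂ + λ₂, α₃ + α, α₄, α₅], [λ₁ − λ₃ − t, α₂ + α₄ + α₅, α₃ + λ₃, 0, 0], [λ₁ − λ₂ − t − α, α₂ + λ₂ − λ₄, α₃ + α, α₄ + λ₄, α₅], [λ₁ − λ₂ − t − α, α₂ + λ₂ − λ₅, α₃ + α, α₄, α₅ + λ₅]] has all entries nonnegative and its characteristic polynomial equals ∏_{i=1}^{5}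 (X − λᵢ). -/
open Polynomial Matrix

/-- The explicit `5 × 5` realization with two positive and three negative eigenvalues
(equation (2.6) of the paper). -/
theorem stmt_7 (l₁ l₂ l₃ l₄ l₅ α₂ α₃ α₄ α₅ α : ℝ)
    (h12 : l₁ ≥ l₂) (h2 : l₂ > 0) (h3 : 0 > l₃) (h34 : l₃ ≥ l₄) (h45 : l₄ ≥ l₅)
    (hα₂ : α₂ ≥ -l₂) (hα₃ : α₃ ≥ -l₃) (hα₄ : α₄ ≥ -l₄) (hα₅ : α₅ ≥ -l₅)
    (h45' : α₄ + α₅ ≥ l₂)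
    (ht : α₂ + α₃ + α₄ + α₅ ≤ l₁)
    (hαlo : -α₃ ≤ α) (hαhi : α ≤ l₁ - l₂ - (α₂ + α₃ + α₄ + α₅)) :
    (∀ i j, 0 ≤ (!![l₁ - (α₂ + α₃ + α₄ + α₅), α₂ + α₄ + α₅, α₃, 0, 0;
                    l₁ - l₂ - (α₂ + α₃ + α₄ + α₅) - α, α₂ + l₂, α₃ + α, α₄, α₅;
                    l₁ - l₃ - (α₂ + α₃ + α₄ + α₅), α₂ + α₄ + α₅, α₃ + l₃, 0, 0;
                    l₁ - l₂ - (α₂ + α₃ + α₄ + α₅) - α, α₂ + l₂ - l₄, α₃ + α, α₄ + l₄, α₅;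
                    l₁ - l₂ - (α₂ + α₃ + α₄ + α₅) - α, α₂ + l₂ - l₅, α₃ + α, α₄, α₅ + l₅]
                  : Matrix (Fin 5) (Fin 5) ℝ) i j) ∧
      (!![l₁ - (α₂ + α₃ + α₄ + α₅), α₂ + α₄ + α₅, α₃, 0, 0;
          l₁ - l₂ - (α₂ + α₃ + α₄ + α₅) - α, α₂ + l₂, α₃ + α, α₄, α₅;
          l₁ - l₃ - (α₂ + α₃ + α₄ + α₅), α₂ + α₄ + α₅, α₃ + l₃, 0, 0;
          l₁ - l₂ - (α₂ + α₃ + α₄ + α₅) - α, α₂ + l₂ - l₄, α₃ + α, α₄ + l₄, α₅;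
          l₁ - l₂ - (α₂ + α₃ + α₄ + α₅) - α, α₂ + l₂ - l₅, α₃ + α, α₄, α₅ + l₅]
        : Matrix (Fin 5) (Fin 5) ℝ).charpoly
        = (X - C l₁) * (X - C l₂) * (X - C l₃) * (X - C l₄) * (X - C l₅) := by
  constructor
  · intro i j
    fin_cases i <;> fin_cases j <;> simp <;> linarith
  · let P : Matrix (Fin 5) (Fin 5) ℝ :=
      !![1, 0, 0, 0, 0; -1, 1, 0, 0, 0; -1, 0, 1, 0, 0; 0, -1, 0, 1, 0; 0, -1, 0, 0, 1]
    let Q : Matrix (Fin 5) (Fin 5) ℝ :=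
      !![1, 0, 0, 0, 0; 1, 1, 0, 0, 0; 1, 0, 1, 0, 0; 1, 1, 0, 1, 0; 1, 1, 0, 0, 1]
    let T : Matrix (Fin 5) (Fin 5) ℝ :=
      !![l₁, α₂ + α₄ + α₅, α₃, 0, 0; 0, l₂, α, α₄, α₅; 0, 0, l₃, 0, 0; 0, 0, 0, l₄, 0;
        0, 0, 0, 0, l₅]
    have hPQ : P * Q = 1 := by
      ext i j
      fin_cases i <;> fin_cases j <;> simp [P, Q, Matrix.mul_apply, Fin.sum_univ_five]
    have hT : T.IsUpperTriangular := by
      intro i j h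
      fin_cases i <;> fin_cases j <;> simp_all [T]
    have hTP : (T * P) * Q = T := by rw [Matrix.mul_assoc, hPQ, Matrix.mul_one]
    trans (Q * (T * P)).charpoly
    · congr 1
      ext i j
      fin_cases i <;> fin_cases j <;> simp [P, Q, T, Matrix.mul_apply, Fin.sum_univ_five] <;> ring
    · rw [Matrix.charpoly_mul_comm, hTP, Matrix.charpoly_of_isUpperTriangular _ hT]
      simp [T, Fin.prod_univ_five]
end

section
/- Let λ₁, …, λ₆, α₂, …, α₆, a₂₄, a₃₄, a₃₅ be real numbers with λ₁ ≥ λ₂ ≥ λ₃ > 0 > λ₄ ≥ λ₅ ≥ λ₆, αᵢ ≥ −λᵢ for i = 2, …, 6, t := α₂ + α₃ + α₄ + α₅ + α₆ ≤ λ₁, α₂ + α₃ + α₅ + α₆ ≥ 0, α₃ + α₆ ≥ 0, −α₅ ≤ a₃₅ ≤ α₂ + λ₂ − λ₃, −α₄ ≤ a₂₄ ≤ λ₁ − λ₂ − t, and −α₄ ≤ a₂₄ + a₃₄ ≤ λ₁ − λ₂ − t. Then the 6×6 matrix C = [[λ₁ − t, t − α₄, 0, α₄, 0, 0], [λ₁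 − λ₂ − t − a₂₄, α₂ + λ₂, α₆ + α₃, α₄ + a₂₄, α₅, 0], [λ₁ − λ₂ − t − a₂₄ − a₃₄, α₂ + λ₂ − λ₃ − a₃₅, α₃ + λ₃, α₄ + a₂₄ + a₃₄, α₅ + a₃₅, α₆], [λ₁ − λ₄ − t, t − α₄, 0, α₄ + λ₄, 0, 0], [λ₁ − λ₂ − t − a₂₄, α₂ + λ₂ − λ₅, α₆ + α₃, α₄ + a₂₄, α₅ + λ₅, 0], [λ₁ − λ₂ − t − a₂₄ − a₃₄, α₂ + λ₂ − λ₃ − a₃₅, α₃ + λ₃ − λ₆, α₄ + a₂₄ + a₃₄, α₅ + a₃₅, α₆ + λ₆]] has all entries nonnegative and its characteristic polynomial equals ∏_{i=1}^{6} (X − λᵢ). -/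
open Polynomial Matrix

/-- A unipotent matrix whose conjugation action triangularizes the realization. -/
def unipotentChange : Matrix (Fin 6) (Fin 6) ℝ :=
  !![1, 0, 0, 0, 0, 0;
     -1, 1, 0, 0, 0, 0;
     0, -1, 1, 0, 0, 0;
     -1, 0, 0, 1, 0, 0;
     0, -1, 0, 0, 1, 0;
     0, 0, -1, 0, 0, 1]

/-- The inverse of `unipotentChange`. -/
def unipotentChangeInv : Matrix (Fin 6) (Fin 6) ℝ :=
  !![1, 0, 0, 0, 0, 0;
     1, 1, 0, 0, 0, 0;
     1, 1, 1, 0, 0, 0;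
     1, 0, 0, 1, 0, 0;
     1, 1, 0, 0, 1, 0;
     1, 1, 1, 0, 0, 1]

theorem unipotentChangeInv_mul : unipotentChangeInv * unipotentChange = 1 := by
  ext i j
  fin_cases i <;> fin_cases j <;>
    simp [unipotentChange, unipotentChangeInv, Matrix.mul_apply, Fin.sum_univ_succ]

theorem charpoly_eq_charpoly_conj (M : Matrix (Fin 6) (Fin 6) ℝ) :
    M.charpoly = (unipotentChange * M * unipotentChangeInv).charpoly := by
  rw [Matrix.charpoly_mul_comm, ← Matrix.mul_assoc, unipotentChangeInv_mul, Matrix.one_mul]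

/-- The explicit `6 × 6` realization with three positive eigenvalues
(equation (2.7) of the paper), where `t = α₂ + α₃ + α₄ + α₅ + α₆`. -/
theorem stmt_8 (l₁ l₂ l₃ l₄ l₅ l₆ α₂ α₃ α₄ α₅ α₆ a₂₄ a₃₄ a₃₅ : ℝ)
    (h12 : l₁ ≥ l₂) (h23 : l₂ ≥ l₃) (h3 : l₃ > 0) (h4 : 0 > l₄) (h45 : l₄ ≥ l₅)
    (h56 : l₅ ≥ l₆)
    (hα₂ : α₂ ≥ -l₂) (hα₃ : α₃ ≥ -l₃) (hα₄ : α₄ ≥ -l₄) (hα₅ : α₅ ≥ -l₅) (hα₆ : α₆ ≥ -l₆)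
    (t : ℝ) (ht : t = α₂ + α₃ + α₄ + α₅ + α₆) (htl : t ≤ l₁)
    (hpos1 : α₂ + α₃ + α₅ + α₆ ≥ 0) (hpos2 : α₃ + α₆ ≥ 0)
    (h35lo : -α₅ ≤ a₃₅) (h35hi : a₃₅ ≤ α₂ + l₂ - l₃)
    (h24lo : -α₄ ≤ a₂₄) (h24hi : a₂₄ ≤ l₁ - l₂ - t)
    (h2434lo : -α₄ ≤ a₂₄ + a₃₄) (h2434hi : a₂₄ + a₃₄ ≤ l₁ - l₂ - t)
    (M : Matrix (Fin 6) (Fin 6) ℝ)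
    (hM : M = !![l₁ - t, t - α₄, 0, α₄, 0, 0;
                 l₁ - l₂ - t - a₂₄, α₂ + l₂, α₆ + α₃, α₄ + a₂₄, α₅, 0;
                 l₁ - l₂ - t - a₂₄ - a₃₄, α₂ + l₂ - l₃ - a₃₅, α₃ + l₃,
                   α₄ + a₂₄ + a₃₄, α₅ + a₃₅, α₆;
                 l₁ - l₄ - t, t - α₄, 0, α₄ + l₄, 0, 0;
                 l₁ - l₂ - t - a₂₄, α₂ + l₂ - l₅, α₆ + α₃, α₄ + a₂₄, α₅ + l₅, 0;
                 l₁ - l₂ - t - a₂₄ - a₃₄, α₂ + l₂ - l₃ - a₃₅, α₃ + l₃ - l₆,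
                   α₄ + a₂₄ + a₃₄, α₅ + a₃₅, α₆ + l₆]) :
    (∀ i j, 0 ≤ M i j) ∧
      M.charpoly = (X - C l₁) * (X - C l₂) * (X - C l₃) * (X - C l₄) * (X - C l₅)
        * (X - C l₆) := by
  constructor
  · subst hM
    intro i j
    fin_cases i <;> fin_cases j <;> simp <;> linarith
  · obtain ⟨T, hT⟩ : ∃ T, T = unipotentChange * M * unipotentChangeInv := ⟨_, rfl⟩
    have hTri : T = !![l₁, t - α₄, 0, α₄, 0, 0;
                       0, l₂, α₃ + α₆, a₂₄, α₅, 0;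
                       0, 0, l₃, a₃₄, a₃₅, α₆;
                       0, 0, 0, l₄, 0, 0;
                       0, 0, 0, 0, l₅, 0;
                       0, 0, 0, 0, 0, l₆] := by
      subst ht hM hT
      ext i j
      fin_cases i <;> fin_cases j <;>
        simp [unipotentChange, unipotentChangeInv, Matrix.mul_apply, Fin.sum_univ_succ] <;> ring
    rw [charpoly_eq_charpoly_conj, ← hT, Matrix.charpoly_of_isUpperTriangular]
    · simp [hTri, Fin.prod_univ_succ, mul_assoc]
    · subst hTri
      intro i j hij
      fin_cases i <;> fin_cases j <;> simp at hij ⊢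
end

section
/- Let λ₁, λ₂, μ₂ be real numbers with λ₂ > 0, μ₂ > 0 and λ₁ ≥ √(λ₂² + μ₂²). Then there exists a 3×3 real matrix M with all entries nonnegative whose characteristic polynomial equals (X − λ₁)·(X² + 2λ₂X + λ₂² + μ₂²) (i.e., whose spectrum is {λ₁, −λ₂ + iμ₂, −λ₂ − iμ₂}) if and only if λ₁ ≥ 2λ₂ + 3·max{0, μ₂/√3 − λ₂}. -/
open Polynomial Matrix

theorem eval_charpoly_fin_three {R : Type*} [CommRing R] (M : Matrix (Fin 3) (Fin 3) R) (x : R) :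
    M.charpoly.eval x = x ^ 3 - (M 0 0 + M 1 1 + M 2 2) * x ^ 2
      + (M 0 0 * M 1 1 - M 0 1 * M 1 0 + (M 0 0 * M 2 2 - M 0 2 * M 2 0)
        + (M 1 1 * M 2 2 - M 1 2 * M 2 1)) * x - M.det := by
  rw [Matrix.eval_charpoly, det_fin_three, det_fin_three]
  simp
  ring

/-- For a nonnegative `3 × 3` matrix, three times the sum of the principal `2 × 2` minors is at
most the square of the trace. -/
theorem three_mul_minors_le_trace_sq (M : Matrix (Fin 3) (Fin 3) ℝ) (hM : ∀ i j, 0 ≤ M i j) :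
    3 * (M 0 0 * M 1 1 - M 0 1 * M 1 0 + (M 0 0 * M 2 2 - M 0 2 * M 2 0)
        + (M 1 1 * M 2 2 - M 1 2 * M 2 1)) ≤ (M 0 0 + M 1 1 + M 2 2) ^ 2 := by
  nlinarith [mul_nonneg (hM 0 1) (hM 1 0), mul_nonneg (hM 0 2) (hM 2 0),
    mul_nonneg (hM 1 2) (hM 2 1), sq_nonneg (M 0 0 - M 1 1), sq_nonneg (M 0 0 - M 2 2),
    sq_nonneg (M 1 1 - M 2 2)]

theorem two_mul_add_three_mul_max_le_iff (a b c : ℝ) (ha : 0 < a) (hb : 0 < b) :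
    2 * a + 3 * max 0 (b / √3 - a) ≤ c ↔ 2 * a ≤ c ∧ 3 * b ^ 2 ≤ (c + a) ^ 2 ∧ 0 ≤ c + a := by
  have h3 : √3 ^ 2 = (3 : ℝ) := Real.sq_sqrt (by norm_num)
  have hpos : 0 < √(3 : ℝ) := by positivity
  have hdiv : 3 * (b / √3) = √3 * b := by
    field_simp
    rw [h3]
  have hsq : 3 * b ^ 2 = (√3 * b) ^ 2 := by rw [mul_pow, h3]
  rw [hsq]
  have hsb : 0 ≤ √3 * b := by positivity
  constructor
  · intro h
    have h₀ := le_max_left 0 (b / √3 - a)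
    have h₁ := le_max_right 0 (b / √3 - a)
    exact ⟨by linarith, pow_le_pow_left₀ hsb (by linarith) 2, by linarith⟩
  · rintro ⟨h₀, h₁, hc⟩
    have h₂ := (sq_le_sq₀ hsb hc).mp h₁
    rcases max_choice 0 (b / √3 - a) with h | h <;> rw [h] <;> linarith

/-- For `λ₂ > 0`, `μ₂ > 0` and `λ₁ ≥ √(λ₂² + μ₂²)`, the spectrum
`{λ₁, -λ₂ + iμ₂, -λ₂ - iμ₂}` is realizable by a nonnegative `3 × 3` matrix if and
only if `λ₁ ≥ 2λ₂ + 3 max{0, μ₂/√3 - λ₂}`. -/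
theorem stmt_10 (l₁ l₂ μ₂ : ℝ) (h₂ : l₂ > 0) (hμ : μ₂ > 0)
    (hperron : Real.sqrt (l₂ ^ 2 + μ₂ ^ 2) ≤ l₁) :
    (∃ M : Matrix (Fin 3) (Fin 3) ℝ,
      (∀ i j, 0 ≤ M i j) ∧
        M.charpoly = (X - C l₁) * (X ^ 2 + C (2 * l₂) * X + C (l₂ ^ 2 + μ₂ ^ 2))) ↔
      2 * l₂ + 3 * max 0 (μ₂ / Real.sqrt 3 - l₂) ≤ l₁ := by
  have hl₁ : 0 ≤ l₁ := (Real.sqrt_nonneg _).trans hperron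
  rw [two_mul_add_three_mul_max_le_iff l₂ μ₂ l₁ h₂ hμ]
  constructor
  · rintro ⟨M, hM, hchar⟩
    have heval (x : ℝ) := (eval_charpoly_fin_three M x).symm.trans (congrArg (eval x) hchar)
    simp only [eval_mul, eval_sub, eval_add, eval_pow, eval_X, eval_C] at heval
    have e₀ := heval 0
    have e₁ := heval 1
    have e₂ := heval (-1)
    have htr : M 0 0 + M 1 1 + M 2 2 = l₁ - 2 * l₂ := by linarith
    have hminors : M 0 0 * M 1 1 - M 0 1 * M 1 0 + (M 0 0 * M 2 2 - M 0 2 * M 2 0)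
        + (M 1 1 * M 2 2 - M 1 2 * M 2 1) = l₂ ^ 2 + μ₂ ^ 2 - 2 * l₁ * l₂ := by linarith
    have hle := three_mul_minors_le_trace_sq M hM
    rw [hminors, htr] at hle
    exact ⟨by linarith [hM 0 0, hM 1 1, hM 2 2], by linarith, by linarith⟩
  · rintro ⟨htr, hsq, -⟩
    set a := (l₁ - 2 * l₂) / 3 with ha
    set s := (l₁ + l₂) / 3 with hs
    have ha₀ : 0 ≤ a := by linarith
    have hs₀ : 0 ≤ s := by linarith
    have hp : 0 ≤ 3 * s ^ 2 - μ₂ ^ 2 := by rw [hs]; linarith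
    have hq : 0 ≤ 2 * s * (s ^ 2 + μ₂ ^ 2) := by positivity
    refine ⟨!![a, 1, 0; 0, a, 1; 2 * s * (s ^ 2 + μ₂ ^ 2), 3 * s ^ 2 - μ₂ ^ 2, a], ?_, ?_⟩
    · intro i j
      fin_cases i <;> fin_cases j <;> simp <;> linarith
    · refine Polynomial.funext fun x => ?_
      rw [eval_charpoly_fin_three, det_fin_three]
      simp [ha, hs]
      ring
end

section
/- Let λ₁, λ₂, μ₂, l be real numbers with λ₂ > 0, μ₂ > 0, λ₁ − λ₂ ≥ 2μ₂, and ((λ₁ − λ₂) − √((λ₁ − λ₂)² − 4μ₂²))/(2μ₂) ≤ l ≤ ((λ₁ − λ₂) + √((λ₁ − λ₂)² − 4μ₂²))/(2μ₂). Then the 3×3 matrix C = [[λ₁ − l·μ₂, μ₂, 0], [−μ₂(l² + 1) + l(λ₁ − λ₂), l·μ₂ + λ₂, μ₂], [λ₁ − λ₂, 0, λ₂]] has all entries nonnegative and its characteristic polynomial equals (X − λ₁)·(X² − 2λ₂X + λ₂² + μ₂²) (i.e., C has spectrum {λ₁, λ₂ + iμ₂, λ₂ − iμ₂}). -/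
open Polynomial Matrix

/-- Explicit `3 × 3` nonnegative realization of `{λ₁, λ₂ ± iμ₂}` with `λ₂ > 0`. -/
theorem stmt_11 (l₁ l₂ μ₂ l : ℝ) (h₂ : l₂ > 0) (hμ : μ₂ > 0)
    (hgap : l₁ - l₂ ≥ 2 * μ₂)
    (hlo : ((l₁ - l₂) - Real.sqrt ((l₁ - l₂) ^ 2 - 4 * μ₂ ^ 2)) / (2 * μ₂) ≤ l)
    (hhi : l ≤ ((l₁ - l₂) + Real.sqrt ((l₁ - l₂) ^ 2 - 4 * μ₂ ^ 2)) / (2 * μ₂)) :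
    (∀ i j, 0 ≤ (!![l₁ - l * μ₂, μ₂, 0;
                    -μ₂ * (l ^ 2 + 1) + l * (l₁ - l₂), l * μ₂ + l₂, μ₂;
                    l₁ - l₂, 0, l₂] : Matrix (Fin 3) (Fin 3) ℝ) i j) ∧
      (!![l₁ - l * μ₂, μ₂, 0;
          -μ₂ * (l ^ 2 + 1) + l * (l₁ - l₂), l * μ₂ + l₂, μ₂;
          l₁ - l₂, 0, l₂] : Matrix (Fin 3) (Fin 3) ℝ).charpoly
        = (X - C l₁) * (X ^ 2 - C (2 * l₂) * X + C (l₂ ^ 2 + μ₂ ^ 2)) := by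
  set s := Real.sqrt ((l₁ - l₂) ^ 2 - 4 * μ₂ ^ 2)
  rw [div_le_iff₀ (by positivity)] at hlo
  rw [le_div_iff₀ (by positivity)] at hhi
  have hsq : s ^ 2 = (l₁ - l₂) ^ 2 - 4 * μ₂ ^ 2 := Real.sq_sqrt (by nlinarith)
  have hsd : s ≤ l₁ - l₂ := abs_le_of_sq_le_sq' (by nlinarith) (by linarith) |>.2
  have hlμ : 0 ≤ l * μ₂ := by linarith
  have hentry : 0 ≤ -μ₂ * (l ^ 2 + 1) + l * (l₁ - l₂) := by
    refine nonneg_of_mul_nonneg_right (a := μ₂) ?_ hμ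
    nlinarith [mul_nonneg (sub_nonneg.2 hlo) (sub_nonneg.2 hhi)]
  refine ⟨fun i j => ?_, ?_⟩
  · fin_cases i <;> fin_cases j <;> simp <;> linarith
  · rw [Matrix.charpoly, Matrix.det_fin_three]
    have hC : (C 2 : ℝ[X]) = 2 := rfl
    simp [hC]
    ring
end

section
/- Let λ₁, λ₂, μ₂, l be real numbers with λ₂ < 0, μ₂ > 0, μ₂²l² − l·μ₂(λ₁ − 2λ₂) + μ₂² + λ₂² ≤ 0, and −2λ₂ ≤ l·μ₂ ≤ λ₁. Then the 3×3 matrix C = [[λ₁ − l·μ₂, μ₂, 0], [−(μ₂²l² − l·μ₂(λ₁ − 2λ₂) + μ₂² + λ₂²)/μ₂, l·μ₂ + 2λ₂, μ₂], [(μ₂² + λ₂²)·λ₁/μ₂², 0, 0]] has all entries nonnegative and its characteristic polynomial equals (X − λ₁)·(X² − 2λ₂X + λ₂² + μ₂²) (i.e., C has spectrum {λ₁, λ₂ + iμ₂, λ₂ − iμ₂}). -/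
open Polynomial Matrix

theorem charpoly_fin_three_of_zeros {R : Type*} [CommRing R] (a b c d e f : R) :
    (!![a, b, 0; c, d, f; e, 0, 0] : Matrix (Fin 3) (Fin 3) R).charpoly =
      X ^ 3 - C (a + d) * X ^ 2 + C (a * d - b * c) * X - C (b * f * e) := by
  rw [Matrix.charpoly, Matrix.det_fin_three]
  simp
  ring

/-- Explicit `3 × 3` nonnegative realization of `{λ₁, λ₂ ± iμ₂}` with `λ₂ < 0`. -/
theorem stmt_12 (l₁ l₂ μ₂ l : ℝ) (h₂ : l₂ < 0) (hμ : μ₂ > 0)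
    (hquad : μ₂ ^ 2 * l ^ 2 - l * μ₂ * (l₁ - 2 * l₂) + μ₂ ^ 2 + l₂ ^ 2 ≤ 0)
    (hlo : -2 * l₂ ≤ l * μ₂) (hhi : l * μ₂ ≤ l₁) :
    (∀ i j, 0 ≤ (!![l₁ - l * μ₂, μ₂, 0;
                    -(μ₂ ^ 2 * l ^ 2 - l * μ₂ * (l₁ - 2 * l₂) + μ₂ ^ 2 + l₂ ^ 2) / μ₂,
                      l * μ₂ + 2 * l₂, μ₂;
                    (μ₂ ^ 2 + l₂ ^ 2) * l₁ / μ₂ ^ 2, 0, 0]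
                  : Matrix (Fin 3) (Fin 3) ℝ) i j) ∧
      (!![l₁ - l * μ₂, μ₂, 0;
          -(μ₂ ^ 2 * l ^ 2 - l * μ₂ * (l₁ - 2 * l₂) + μ₂ ^ 2 + l₂ ^ 2) / μ₂,
            l * μ₂ + 2 * l₂, μ₂;
          (μ₂ ^ 2 + l₂ ^ 2) * l₁ / μ₂ ^ 2, 0, 0]
        : Matrix (Fin 3) (Fin 3) ℝ).charpoly
        = (X - C l₁) * (X ^ 2 - C (2 * l₂) * X + C (l₂ ^ 2 + μ₂ ^ 2)) := by
  constructor
  · have hl₁ : 0 ≤ l₁ := by linarith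
    have h₂₁ : 0 ≤ -(μ₂ ^ 2 * l ^ 2 - l * μ₂ * (l₁ - 2 * l₂) + μ₂ ^ 2 + l₂ ^ 2) / μ₂ :=
      div_nonneg (by linarith) hμ.le
    have h₃₁ : 0 ≤ (μ₂ ^ 2 + l₂ ^ 2) * l₁ / μ₂ ^ 2 := by positivity
    have h₂₂ : 0 ≤ l * μ₂ + 2 * l₂ := by linarith
    intro i j
    fin_cases i <;> fin_cases j
    exacts [sub_nonneg.2 hhi, hμ.le, le_rfl, h₂₁, h₂₂, hμ.le, h₃₁, le_rfl, le_rfl]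
  · rw [charpoly_fin_three_of_zeros]
    have hlin : (l₁ - l * μ₂) * (l * μ₂ + 2 * l₂) -
        μ₂ * (-(μ₂ ^ 2 * l ^ 2 - l * μ₂ * (l₁ - 2 * l₂) + μ₂ ^ 2 + l₂ ^ 2) / μ₂) =
        2 * l₁ * l₂ + (l₂ ^ 2 + μ₂ ^ 2) := by
      field_simp
      ring
    have hconst : μ₂ * μ₂ * ((μ₂ ^ 2 + l₂ ^ 2) * l₁ / μ₂ ^ 2) = l₁ * (l₂ ^ 2 + μ₂ ^ 2) := by
      field_simp
      ring
    rw [hlin, hconst]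
    simp only [map_add, map_sub, map_mul, map_pow, map_ofNat]
    ring
end

section
/- Let a be a real number with −2 ≤ a ≤ −1. Then the 8×8 matrix C = [[0,1,5,5,3,3,2,0], [−1−a,0,5,5,3,3,2+a,2], [5,1,0,5,3,3,2,0], [5,1,5,0,3,3,2,0], [3,1,5,5,0,3,2,0], [3,1,5,5,3,0,2,0], [2,1,5,5,3,3,0,0], [−1−a,2,5,5,3,3,2+a,0]] has all entries nonnegative and its characteristic polynomial equals (X − 19)(X − 1)(X + 5)²(X + 3)²(X + 2)², i.e., its spectrum counted with multiplicity is {19, 1, −5, −5, −3, −3, −2, −2}. -/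
open Polynomial Matrix

/-- The upper triangular form, in the basis `(1, …, 1), e₁ + e₇, e₂, …, e₇`, of the matrix of
`stmt_14`. -/
def triangularForm (a : ℝ) : Matrix (Fin 8) (Fin 8) ℝ :=
  !![19, 1, 5, 5, 3, 3, 2, 0;
     0, 1, 0, 0, 0, 0, a, 2;
     0, 0, -5, 0, 0, 0, 0, 0;
     0, 0, 0, -5, 0, 0, 0, 0;
     0, 0, 0, 0, -3, 0, 0, 0;
     0, 0, 0, 0, 0, -3, 0, 0;
     0, 0, 0, 0, 0, 0, -2, 0;
     0, 0, 0, 0, 0, 0, 0, -2]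

/-- The matrix with columns `(1, …, 1), e₁ + e₇, e₂, …, e₇`. -/
def basisChange : Matrix (Fin 8) (Fin 8) ℝ :=
  !![1, 0, 0, 0, 0, 0, 0, 0;
     1, 1, 0, 0, 0, 0, 0, 0;
     1, 0, 1, 0, 0, 0, 0, 0;
     1, 0, 0, 1, 0, 0, 0, 0;
     1, 0, 0, 0, 1, 0, 0, 0;
     1, 0, 0, 0, 0, 1, 0, 0;
     1, 0, 0, 0, 0, 0, 1, 0;
     1, 1, 0, 0, 0, 0, 0, 1]

/-- The inverse of `basisChange`. -/
def basisChangeInv : Matrix (Fin 8) (Fin 8) ℝ :=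
  !![1, 0, 0, 0, 0, 0, 0, 0;
     -1, 1, 0, 0, 0, 0, 0, 0;
     -1, 0, 1, 0, 0, 0, 0, 0;
     -1, 0, 0, 1, 0, 0, 0, 0;
     -1, 0, 0, 0, 1, 0, 0, 0;
     -1, 0, 0, 0, 0, 1, 0, 0;
     -1, 0, 0, 0, 0, 0, 1, 0;
     0, -1, 0, 0, 0, 0, 0, 1]

lemma basisChangeInv_mul_basisChange : basisChangeInv * basisChange = 1 := by
  ext i j
  fin_cases i <;> fin_cases j <;>
    simp [basisChangeInv, basisChange, Matrix.mul_apply, Fin.sum_univ_succ]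

lemma charpoly_eq_of_mul_eq_mul {n R : Type*} [Fintype n] [DecidableEq n] [CommRing R]
    {A B P Q : Matrix n n R} (hQP : Q * P = 1) (h : A * P = P * B) :
    A.charpoly = B.charpoly := by
  have hA : A = P * (B * Q) := by
    rw [← Matrix.mul_assoc, ← h, Matrix.mul_assoc, mul_eq_one_comm.mp hQP, Matrix.mul_one]
  rw [hA, Matrix.charpoly_mul_comm, Matrix.mul_assoc, hQP, Matrix.mul_one]

lemma triangularForm_charpoly (a : ℝ) :
    (triangularForm a).charpoly = (X - C 19) * (X - C 1) * (X + C 5) ^ 2 * (X + C 3) ^ 2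
      * (X + C 2) ^ 2 := by
  have h : (triangularForm a).BlockTriangular id := by
    intro i j hij
    fin_cases i <;> fin_cases j <;> first | rfl | exact absurd hij (by decide)
  rw [charpoly_of_isUpperTriangular _ h]
  simp [triangularForm, Fin.prod_univ_succ]
  ring

/-- For `-2 ≤ a ≤ -1`, the displayed `8 × 8` matrix is nonnegative with spectrum
`{19, 1, -5, -5, -3, -3, -2, -2}`. -/
theorem stmt_14 (a : ℝ) (ha₁ : -2 ≤ a) (ha₂ : a ≤ -1)
    (M : Matrix (Fin 8) (Fin 8) ℝ)
    (hM : M = !![0, 1, 5, 5, 3, 3, 2, 0;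
                 -1 - a, 0, 5, 5, 3, 3, 2 + a, 2;
                 5, 1, 0, 5, 3, 3, 2, 0;
                 5, 1, 5, 0, 3, 3, 2, 0;
                 3, 1, 5, 5, 0, 3, 2, 0;
                 3, 1, 5, 5, 3, 0, 2, 0;
                 2, 1, 5, 5, 3, 3, 0, 0;
                 -1 - a, 2, 5, 5, 3, 3, 2 + a, 0]) :
    (∀ i j, 0 ≤ M i j) ∧
      M.charpoly = (X - C 19) * (X - C 1) * (X + C 5) ^ 2 * (X + C 3) ^ 2
        * (X + C 2) ^ 2 := by
  subst hM
  constructor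
  · intro i j
    fin_cases i <;> fin_cases j <;> simp <;> linarith
  · rw [← triangularForm_charpoly a]
    apply charpoly_eq_of_mul_eq_mul basisChangeInv_mul_basisChange
    ext i j
    fin_cases i <;> fin_cases j <;>
      simp [triangularForm, basisChange, Matrix.mul_apply, Fin.sum_univ_succ] <;>
      ring
end

section
/- Let l₂ and l₅ be real numbers with 1/2 ≤ l₂ ≤ 2/3 and 1/2 ≤ l₅ ≤ 3/4. Then the 5×5 matrix C = [[0,6,0,0,0], [2−3l₂,0,3,4,0], [3−4l₅,−3+6l₂,0,0,4], [2−3l₂,4,3,0,0], [3−4l₂,−3+6l₅,4,0,0]] has all entries nonnegative and its characteristic polynomial equals (X − 6)(X − 1)²(X + 4)², i.e., its spectrum counted with multiplicity is {6, 1, 1, −4, −4}. -/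
open Polynomial Matrix

/-- For `1/2 ≤ l₂ ≤ 2/3` and `1/2 ≤ l₅ ≤ 3/4`, the displayed `5 × 5` matrix is
nonnegative with spectrum `{6, 1, 1, -4, -4}`. -/
theorem stmt_15 (l₂ l₅ : ℝ)
    (h₂lo : 1 / 2 ≤ l₂) (h₂hi : l₂ ≤ 2 / 3) (h₅lo : 1 / 2 ≤ l₅) (h₅hi : l₅ ≤ 3 / 4)
    (M : Matrix (Fin 5) (Fin 5) ℝ)
    (hM : M = !![0, 6, 0, 0, 0;
                 2 - 3 * l₂, 0, 3, 4, 0;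
                 3 - 4 * l₅, -3 + 6 * l₂, 0, 0, 4;
                 2 - 3 * l₂, 4, 3, 0, 0;
                 3 - 4 * l₂, -3 + 6 * l₅, 4, 0, 0]) :
    (∀ i j, 0 ≤ M i j) ∧
      M.charpoly = (X - C 6) * (X - C 1) ^ 2 * (X + C 4) ^ 2 := by
  subst hM
  refine ⟨fun i j => ?_, ?_⟩
  · fin_cases i <;> fin_cases j <;> simp <;> linarith
  · refine Polynomial.funext fun x => ?_
    rw [eval_charpoly]
    simp [det_succ_row_zero, Fin.sum_univ_succ, Fin.succAbove, scalar_apply]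
    ring
end

section
/- There exists a 5×5 real matrix M with all entries nonnegative whose characteristic polynomial equals (X − 12)(X² + 3)(X² − 8X + 25), i.e., whose spectrum counted with multiplicity is {12, i√3, −i√3, 4 + 3i, 4 − 3i}. -/
open Polynomial Matrix

/-- There is a nonnegative `5 × 5` matrix with spectrum
`{12, i√3, -i√3, 4 + 3i, 4 - 3i}`. -/
theorem stmt_19 :
    ∃ M : Matrix (Fin 5) (Fin 5) ℝ,
      (∀ i j, 0 ≤ M i j) ∧
        M.charpoly = (X - C 12) * (X ^ 2 + C 3) * (X ^ 2 - C 8 * X + C 25) := by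
  refine ⟨!![7, 1, 0, 0, 0;
             0, 0, 1, 0, 0;
             0, 0, 4, 1, 0;
             350, 18, 15, 6, 1;
             3280, 244, 108, 6, 3], fun i j => ?_, ?_⟩
  · fin_cases i <;> fin_cases j <;> simp
  · have hcharmatrix : charmatrix !![7, 1, 0, 0, 0;
        0, 0, 1, 0, 0;
        0, 0, 4, 1, 0;
        350, 18, 15, 6, 1;
        3280, 244, 108, 6, (3 : ℝ)] =
        !![X - 7, -1, 0, 0, 0;
           0, X, -1, 0, 0;
           0, 0, X - 4, -1, 0;
           -350, -18, -15, X - 6, -1;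
           -3280, -244, -108, -6, X - 3] := by
      ext1 i j
      fin_cases i <;> fin_cases j <;> simp [C_ofNat]
    rw [Matrix.charpoly, hcharmatrix]
    simp only [C_ofNat]
    simp [det_succ_row_zero, Fin.sum_univ_succ, Fin.succAbove]
    ring
end
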